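/- Let g ≥ 3 and let Γ be any metric graph whose underlying combinatorial model is the genus-g graph O_g, i.e., Γ consists of g loops l₁, …, l_g, where loop l_i is based at a vertex V_i, each V_i is joined by a bridge edge h_i to a path of vertices W₀, …, W_{g−3} (with h₁ attaching V₁ to W₀, h_i attaching V_i to W_{i−2} for 2 ≤ i ≤ g−1, and h_g attaching V_g to W_{g−3}, and consecutive W_i joined by edges e₀, …, e_{g−4}), all edges having arbitrary positive lengths. Then every point x ∈ Γ is a Weierstrass point of Γ. -/

import Mathlib

open scoped Classical

noncomputable section

/-! ## Combinatorial models of metric graphs and their topological realizations -/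

/-- A combinatorial model of a metric graph: a finite multigraph with positive
edge lengths. -/
structure CombGraph : Type 1 where
  V : Type
  E : Type
  fintypeV : Fintype V
  fintypeE : Fintype E
  src : E → V
  tgt : E → V
  len : E → ℝ
  len_pos : ∀ e, 0 < len e

attribute [instance] CombGraph.fintypeV CombGraph.fintypeE

namespace CombGraph

variable (G : CombGraph)

instance : TopologicalSpace G.V := ⊥
instance : TopologicalSpace G.E := ⊥

/-- The disjoint union of the vertices and of the edges seen as real intervals,
before gluing. -/
def Pre : Type := G.V ⊕ (G.E × ℝ)

instance : TopologicalSpace G.Pre := inferInstanceAs (TopologicalSpace (G.V ⊕ (G.E × ℝ)))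

/-- The predicate selecting legitimate points: a point of an edge `e` must have its
coordinate in `[0, len e]`. -/
def Ok : G.Pre → Prop
  | Sum.inl _ => True
  | Sum.inr p => 0 ≤ p.2 ∧ p.2 ≤ G.len p.1

/-- Points of the model before gluing. -/
def PreR : Type := {p : G.Pre // G.Ok p}

instance : TopologicalSpace G.PreR := inferInstanceAs (TopologicalSpace {p : G.Pre // G.Ok p})

/-- The gluing relation: the endpoints of each edge are glued to the corresponding
vertices. -/
inductive Glue : G.PreR → G.PreR → Prop
  | srcGlue (e : G.E) :
      Glue ⟨Sum.inl (G.src e), trivial⟩ ⟨Sum.inr (e, 0), ⟨le_refl 0, (G.len_pos e).le⟩⟩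
  | tgtGlue (e : G.E) :
      Glue ⟨Sum.inl (G.tgt e), trivial⟩ ⟨Sum.inr (e, G.len e), ⟨(G.len_pos e).le, le_refl _⟩⟩

/-- The topological realization of the combinatorial model: the underlying
topological space of the associated metric graph. -/
def Space : Type := Quot G.Glue

instance : TopologicalSpace G.Space := inferInstanceAs (TopologicalSpace (Quot G.Glue))

/-- The point of the realization corresponding to a vertex. -/
def vertexPt (v : G.V) : G.Space := Quot.mk _ ⟨Sum.inl v, trivial⟩

/-- Clamping of a real coordinate into `[0, len e]`. -/
def clamp (e : G.E) (t : ℝ) : ℝ := max 0 (min t (G.len e))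

/-- The point of the realization lying on the edge `e` at coordinate `t`
(the coordinate is clamped into `[0, len e]`). -/
def edgePt (e : G.E) (t : ℝ) : G.Space :=
  Quot.mk _ ⟨Sum.inr (e, G.clamp e t),
    ⟨le_max_left 0 _, max_le (G.len_pos e).le (min_le_right _ _)⟩⟩

/-- The genus (first Betti number) of the (connected) metric graph. -/
def genus : ℤ := (Fintype.card G.E : ℤ) - (Fintype.card G.V : ℤ) + 1

/-! ### Outgoing directions, valence -/

/-- `d = (e, b)` is an outgoing unit tangent direction at the point `x`:
if `b = true` it points in the direction of increasing coordinate on `e`, if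
`b = false` in the direction of decreasing coordinate. -/
def IsDir (x : G.Space) (d : G.E × Bool) : Prop :=
  if d.2 then ∃ t, 0 ≤ t ∧ t < G.len d.1 ∧ x = G.edgePt d.1 t
  else ∃ t, 0 < t ∧ t ≤ G.len d.1 ∧ x = G.edgePt d.1 t

/-- The (finite) set of outgoing directions at a point. -/
def dirSet (x : G.Space) : Finset (G.E × Bool) :=
  Finset.univ.filter fun d => G.IsDir x d

/-- The valence of a point of the realization: the number of outgoing
directions at that point. -/
def valence (x : G.Space) : ℕ := (G.dirSet x).card

/-- The coordinate on the edge `d.1` of a point `x` admitting `d` as an outgoing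
direction. -/
def dirCoord (x : G.Space) (d : G.E × Bool) : ℝ :=
  if d.2 then
    (if h : ∃ t, 0 ≤ t ∧ t < G.len d.1 ∧ x = G.edgePt d.1 t then h.choose else 0)
  else
    (if h : ∃ t, 0 < t ∧ t ≤ G.len d.1 ∧ x = G.edgePt d.1 t then h.choose else 0)

/-- The point at distance `u` from `x` in the outgoing direction `d`. -/
def dirPt (x : G.Space) (d : G.E × Bool) (u : ℝ) : G.Space :=
  G.edgePt d.1 (G.dirCoord x d + (if d.2 then u else -u))

end CombGraph

/-! ### Rational functions and divisors -/

/-- A function `g : [0, L] → ℝ` is piecewise integral affine if there is a finite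
subdivision of `[0, L]` on whose pieces `g` is affine with integral slope. -/
def PWIntAffine (g : ℝ → ℝ) (L : ℝ) : Prop :=
  ∃ (n : ℕ) (t : ℕ → ℝ) (m : ℕ → ℤ) (b : ℕ → ℝ),
    t 0 = 0 ∧ t n = L ∧ (∀ i, i < n → t i < t (i + 1)) ∧
    (∀ i, i < n → ∀ u, t i ≤ u → u ≤ t (i + 1) → g u = (m i : ℝ) * u + b i)

/-- A rational function on the metric graph realizing `G`: a continuous function
which is piecewise integral affine on every edge. -/
structure RatFn (G : CombGraph) where
  toFun : G.Space → ℝ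
  continuous : Continuous toFun
  piecewise : ∀ e : G.E, PWIntAffine (fun t => toFun (G.edgePt e t)) (G.len e)

namespace CombGraph

variable (G : CombGraph)

/-- The right-hand slope of a rational function on the edge `e` at coordinate `t`. -/
def rightSlope (f : RatFn G) (e : G.E) (t : ℝ) : ℝ :=
  derivWithin (fun u => f.toFun (G.edgePt e u)) (Set.Ici t) t

/-- The left-hand slope of a rational function on the edge `e` at coordinate `t`. -/
def leftSlope (f : RatFn G) (e : G.E) (t : ℝ) : ℝ :=
  derivWithin (fun u => f.toFun (G.edgePt e u)) (Set.Iic t) t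

/-- The order of a rational function at a point: the sum of its outgoing slopes. -/
def ordAt (f : RatFn G) (x : G.Space) : ℝ :=
  if h : ∃ v : G.V, x = G.vertexPt v then
    ∑ e : G.E,
      ((if G.src e = h.choose then G.rightSlope f e 0 else 0)
        + (if G.tgt e = h.choose then -(G.leftSlope f e (G.len e)) else 0))
  else if h2 : ∃ p : G.E × ℝ, 0 < p.2 ∧ p.2 < G.len p.1 ∧ x = G.edgePt p.1 p.2 then
    G.rightSlope f h2.choose.1 h2.choose.2 - G.leftSlope f h2.choose.1 h2.choose.2
  else 0

/-- The group of divisors of the metric graph: the free abelian group on the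
points of the realization. -/
abbrev Div (G : CombGraph) : Type := G.Space →₀ ℤ

/-- The degree of a divisor. -/
def degDiv (D : Div G) : ℤ := D.sum fun _ n => n

/-- A divisor is effective if all of its coefficients are nonnegative. -/
def Effective (D : Div G) : Prop := ∀ x, 0 ≤ D x

/-- `D` is the principal divisor associated to the rational function `f`. -/
def IsPrincipal (D : Div G) (f : RatFn G) : Prop := ∀ x, (D x : ℝ) = G.ordAt f x

/-- Two divisors are linearly equivalent if their difference is principal. -/
def LinEquiv (D D' : Div G) : Prop := ∃ f : RatFn G, G.IsPrincipal (D - D') f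

/-- The Baker–Norine rank of a divisor: the largest integer `k` such that for every
effective divisor `E` of degree `k` the linear system `|D - E|` is nonempty.  (For
negative `k` the condition is vacuous, so the supremum is `-1` exactly when
`|D|` is empty.) -/
def Rk (D : Div G) : ℤ :=
  sSup {k : ℤ | ∀ E : Div G, G.Effective E → G.degDiv E = k →
    ∃ E' : Div G, G.Effective E' ∧ G.LinEquiv (D - E) E'}

/-- A point of a metric graph is a Weierstrass point if `rk(g·[x]) ≥ 1`. -/
def IsWeierstrass (x : G.Space) : Prop :=
  1 ≤ G.Rk (G.genus • Finsupp.single x 1)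

/-- The canonical divisor of a metric graph. -/
def canonical : Div G :=
  ∑ v : G.V, ((G.valence (G.vertexPt v) : ℤ) - 2) • Finsupp.single (G.vertexPt v) 1

end CombGraph

/-- The edges of the graph `O_g`: `g` loops `l_i`, then `g` bridges `h_i`, then the
`g - 3` path edges `e_j`. -/
abbrev OgE (g : ℕ) : Type := Fin g ⊕ Fin g ⊕ Fin (g - 3)

/-- The vertices of the graph `O_g`: the vertices `V_i` carrying the loops, and the
path vertices `W_j`. -/
abbrev OgV (g : ℕ) : Type := Fin g ⊕ Fin (g - 2)

/-- The genus-`g` graph `O_g` (`g ≥ 3`) with edge lengths `ℓ`: loop `l_i` is based at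
`V_i`; the bridge `h_i` joins `V_i` to `W₀` for `i = 1`, to `W_{i-2}` for
`2 ≤ i ≤ g-1`, and to `W_{g-3}` for `i = g` (`0`-indexed below); the path edge `e_j`
joins `W_j` to `W_{j+1}`. -/
def Og (g : ℕ) (hg : 3 ≤ g) (ℓ : OgE g → ℝ) (hℓ : ∀ e, 0 < ℓ e) : CombGraph where
  V := OgV g
  E := OgE g
  fintypeV := inferInstance
  fintypeE := inferInstance
  src := fun e =>
    match e with
    | Sum.inl i => Sum.inl i
    | Sum.inr (Sum.inl i) => Sum.inl i
    | Sum.inr (Sum.inr j) => Sum.inr ⟨j.val, by have := j.isLt; omega⟩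
  tgt := fun e =>
    match e with
    | Sum.inl i => Sum.inl i
    | Sum.inr (Sum.inl i) => Sum.inr ⟨min (i.val - 1) (g - 3), by
        have := Nat.min_le_right (i.val - 1) (g - 3); omega⟩
    | Sum.inr (Sum.inr j) => Sum.inr ⟨j.val + 1, by have := j.isLt; omega⟩
  len := ℓ
  len_pos := hℓ

namespace CombGraph

variable {G : CombGraph}

/-- The canonical representative of a point of the realization before gluing: a vertex,
or a point in the interior of an edge. -/
def normalForm (x : G.Space) : G.V ⊕ (G.E × ℝ) :=
  Quot.lift
    (fun p : G.PreR =>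
      match p.1 with
      | Sum.inl v => Sum.inl v
      | Sum.inr (e, t) =>
        if t = 0 then Sum.inl (G.src e)
        else if t = G.len e then Sum.inl (G.tgt e) else Sum.inr (e, t))
    (by
      rintro _ _ (e | e)
      · simp
      · simp [(G.len_pos e).ne']) x

lemma clamp_of_mem {e : G.E} {t : ℝ} (h0 : 0 ≤ t) (h1 : t ≤ G.len e) : G.clamp e t = t := by
  rw [clamp, min_eq_left h1, max_eq_right h0]

lemma edgePt_of_mem {e : G.E} {t : ℝ} (h0 : 0 ≤ t) (h1 : t ≤ G.len e) :
    G.edgePt e t = Quot.mk _ ⟨Sum.inr (e, t), h0, h1⟩ := by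
  have h : G.clamp e t = t := clamp_of_mem h0 h1
  unfold edgePt
  congr 3
  rw [h]

@[simp] lemma edgePt_zero (e : G.E) : G.edgePt e 0 = G.vertexPt (G.src e) := by
  rw [edgePt_of_mem le_rfl (G.len_pos e).le]
  exact (Quot.sound (Glue.srcGlue e)).symm

@[simp] lemma edgePt_len (e : G.E) : G.edgePt e (G.len e) = G.vertexPt (G.tgt e) := by
  rw [edgePt_of_mem (G.len_pos e).le le_rfl]
  exact (Quot.sound (Glue.tgtGlue e)).symm

lemma normalForm_vertexPt (v : G.V) : normalForm (G.vertexPt v) = Sum.inl v := rfl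

lemma normalForm_edgePt {e : G.E} {t : ℝ} (h0 : 0 < t) (h1 : t < G.len e) :
    normalForm (G.edgePt e t) = Sum.inr (e, t) := by
  rw [edgePt_of_mem h0.le h1.le]
  simp [normalForm, h0.ne', h1.ne]

lemma vertexPt_injective : Function.Injective G.vertexPt := fun v w h => by
  simpa [normalForm_vertexPt] using congrArg normalForm h

lemma edgePt_ne_vertexPt {e : G.E} {t : ℝ} (h0 : 0 < t) (h1 : t < G.len e) (v : G.V) :
    G.edgePt e t ≠ G.vertexPt v := fun h => by
  simpa [normalForm_vertexPt, normalForm_edgePt h0 h1] using congrArg normalForm h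

lemma edgePt_inj {e e' : G.E} {t t' : ℝ} (h0 : 0 < t) (h1 : t < G.len e)
    (h0' : 0 < t') (h1' : t' < G.len e') (h : G.edgePt e t = G.edgePt e' t') :
    e = e' ∧ t = t' := by
  simpa [normalForm_edgePt h0 h1, normalForm_edgePt h0' h1'] using congrArg normalForm h

lemma exists_eq_edgePt_or_vertexPt (x : G.Space) :
    (∃ v, x = G.vertexPt v) ∨ ∃ e t, 0 < t ∧ t < G.len e ∧ x = G.edgePt e t := by
  induction x using Quot.ind with
  | mk p =>
    obtain ⟨v | ⟨e, t⟩, hp⟩ := p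
    · exact Or.inl ⟨v, rfl⟩
    · have hp' : 0 ≤ t ∧ t ≤ G.len e := hp
      have hx := edgePt_of_mem hp'.1 hp'.2
      rcases hp'.1.eq_or_lt with rfl | h0
      · exact Or.inl ⟨_, hx.symm.trans (edgePt_zero e)⟩
      rcases hp'.2.eq_or_lt with rfl | h1
      · exact Or.inl ⟨_, hx.symm.trans (edgePt_len e)⟩
      exact Or.inr ⟨e, t, h0, h1, hx.symm⟩

lemma ordAt_vertexPt (f : RatFn G) (v : G.V) :
    G.ordAt f (G.vertexPt v) = ∑ e : G.E,
      ((if G.src e = v then G.rightSlope f e 0 else 0)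
        + (if G.tgt e = v then -(G.leftSlope f e (G.len e)) else 0)) := by
  have h : ∃ w : G.V, G.vertexPt v = G.vertexPt w := ⟨v, rfl⟩
  have hv : h.choose = v := (vertexPt_injective h.choose_spec).symm
  rw [ordAt, dif_pos h, hv]

lemma ordAt_edgePt (f : RatFn G) {e : G.E} {t : ℝ} (h0 : 0 < t) (h1 : t < G.len e) :
    G.ordAt f (G.edgePt e t) = G.rightSlope f e t - G.leftSlope f e t := by
  have hn : ¬∃ w : G.V, G.edgePt e t = G.vertexPt w := fun ⟨w, hw⟩ =>
    edgePt_ne_vertexPt h0 h1 w hw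
  have h : ∃ p : G.E × ℝ, 0 < p.2 ∧ p.2 < G.len p.1 ∧ G.edgePt e t = G.edgePt p.1 p.2 :=
    ⟨(e, t), h0, h1, rfl⟩
  obtain ⟨he, ht⟩ := edgePt_inj h0 h1 h.choose_spec.1 h.choose_spec.2.1 h.choose_spec.2.2
  rw [ordAt, dif_neg hn, dif_pos h, ← he, ← ht]

/-! ### Principal divisors have degree zero -/

lemma derivWithin_Ici_of_affine {g : ℝ → ℝ} {a b m k : ℝ} (hab : a < b)
    (h : ∀ u, a ≤ u → u ≤ b → g u = m * u + k) : derivWithin g (Set.Ici a) a = m := by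
  have h1 : HasDerivWithinAt (fun u => m * u + k) m (Set.Ici a) a := by
    simpa using (((hasDerivAt_id a).const_mul m).add_const k).hasDerivWithinAt
  have h2 : g =ᶠ[nhdsWithin a (Set.Ici a)] fun u => m * u + k := by
    filter_upwards [Icc_mem_nhdsGE hab] with u hu using h u hu.1 hu.2
  exact (h1.congr_of_eventuallyEq h2 (h a le_rfl hab.le)).derivWithin
    (uniqueDiffWithinAt_Ici a)

lemma derivWithin_Iic_of_affine {g : ℝ → ℝ} {a b m k : ℝ} (hab : a < b)
    (h : ∀ u, a ≤ u → u ≤ b → g u = m * u + k) : derivWithin g (Set.Iic b) b = m := by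
  have h1 : HasDerivWithinAt (fun u => m * u + k) m (Set.Iic b) b := by
    simpa using (((hasDerivAt_id b).const_mul m).add_const k).hasDerivWithinAt
  have h2 : g =ᶠ[nhdsWithin b (Set.Iic b)] fun u => m * u + k := by
    filter_upwards [Icc_mem_nhdsLE hab] with u hu using h u hu.1 hu.2
  exact (h1.congr_of_eventuallyEq h2 (h b hab.le le_rfl)).derivWithin
    (uniqueDiffWithinAt_Iic b)

/-- The slope changes of a piecewise affine function add up to the difference of its
final and initial slopes. -/
lemma PWIntAffine.sum_slope_change {g : ℝ → ℝ} {L : ℝ} (hL : 0 < L) (hg : PWIntAffine g L)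
    (P : Finset ℝ) (hP : ∀ u ∈ P, 0 < u ∧ u < L)
    (hP' : ∀ u, 0 < u → u < L → u ∉ P →
      derivWithin g (Set.Ici u) u - derivWithin g (Set.Iic u) u = 0) :
    ∑ u ∈ P, (derivWithin g (Set.Ici u) u - derivWithin g (Set.Iic u) u) =
      derivWithin g (Set.Iic L) L - derivWithin g (Set.Ici 0) 0 := by
  obtain ⟨n, t, m, b, ht0, htn, hlt, haff⟩ := hg
  obtain _ | n := n
  · exact absurd (ht0.symm.trans htn) hL.ne
  have hmono : ∀ i j, i < j → j ≤ n + 1 → t i < t j := by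
    intro i j hij
    induction j, hij using Nat.le_induction with
    | base => exact fun h => hlt _ h
    | succ j _ ih => exact fun h => (ih (by omega)).trans (hlt _ (by omega))
  have hR : ∀ i, i < n + 1 → derivWithin g (Set.Ici (t i)) (t i) = m i := fun i hi =>
    derivWithin_Ici_of_affine (hlt i hi) (haff i hi)
  have hLf : ∀ i, i < n + 1 → derivWithin g (Set.Iic (t (i + 1))) (t (i + 1)) = m i :=
    fun i hi => derivWithin_Iic_of_affine (hlt i hi) (haff i hi)
  set J : ℝ → ℝ := fun u => derivWithin g (Set.Ici u) u - derivWithin g (Set.Iic u) u with hJ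
  set T : Finset ℝ := (Finset.range n).image fun i => t (i + 1) with hT
  have hTmem : ∀ u ∈ T, 0 < u ∧ u < L := by
    intro u hu
    obtain ⟨i, hi, rfl⟩ := Finset.mem_image.1 hu
    have hi := Finset.mem_range.1 hi
    exact ⟨ht0 ▸ hmono 0 (i + 1) (by omega) (by omega),
      htn ▸ hmono (i + 1) (n + 1) (by omega) le_rfl⟩
  have hToff : ∀ u, 0 < u → u < L → u ∉ T → J u = 0 := by
    intro u hu0 huL huT
    have hex : ∃ i, u < t i := ⟨n + 1, htn ▸ huL⟩
    have hfind := Nat.find_spec hex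
    have hle : Nat.find hex ≤ n + 1 := Nat.find_min' hex (htn ▸ huL)
    obtain ⟨i, hi⟩ : ∃ i, Nat.find hex = i + 1 := by
      refine Nat.exists_eq_succ_of_ne_zero fun h0 => ?_
      rw [h0, ht0] at hfind
      exact hfind.not_gt hu0
    rw [hi] at hfind hle
    have hge : t i ≤ u := not_lt.1 (Nat.find_min hex (m := i) (by omega))
    have hne : t i ≠ u := by
      rintro rfl
      obtain _ | i := i
      · exact hu0.ne' ht0
      · exact huT (Finset.mem_image.2 ⟨i, Finset.mem_range.2 (by omega), rfl⟩)
    have hgt := lt_of_le_of_ne hge hne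
    have h := haff i (by omega)
    simp only [hJ]
    rw [derivWithin_Ici_of_affine hfind fun w hw hw' => h w (hge.trans hw) hw',
      derivWithin_Iic_of_affine hgt fun w hw hw' => h w hw (hw'.trans hfind.le), sub_self]
  have e1 : ∑ u ∈ P, J u = ∑ u ∈ P ∪ T, J u :=
    Finset.sum_subset Finset.subset_union_left fun u hu huP => by
      have hu' : u ∈ T := (Finset.mem_union.1 hu).resolve_left huP
      exact hP' u (hTmem u hu').1 (hTmem u hu').2 huP
  have e2 : ∑ u ∈ T, J u = ∑ u ∈ P ∪ T, J u :=
    Finset.sum_subset Finset.subset_union_right fun u hu huT => by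
      have hu' : u ∈ P := (Finset.mem_union.1 hu).resolve_right huT
      exact hToff u (hP u hu').1 (hP u hu').2 huT
  have e3 : ∑ u ∈ T, J u = ∑ i ∈ Finset.range n, ((m (i + 1) : ℝ) - m i) := by
    rw [hT, Finset.sum_image]
    · refine Finset.sum_congr rfl fun i hi => ?_
      have hi := Finset.mem_range.1 hi
      simp only [hJ]
      rw [hR _ (by omega), hLf _ (by omega)]
    · intro i hi j hj hij
      have hi := Finset.mem_range.1 (Finset.mem_coe.1 hi)
      have hj := Finset.mem_range.1 (Finset.mem_coe.1 hj)
      rcases lt_trichotomy i j with h | h | h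
      · exact absurd hij (hmono _ _ (by omega) (by omega)).ne
      · exact h
      · exact absurd hij (hmono _ _ (by omega) (by omega)).ne'
  have e4 := hLf n (by omega)
  have e5 := hR 0 (by omega)
  rw [htn] at e4
  rw [ht0] at e5
  rw [e1, ← e2, e3, Finset.sum_range_sub (fun i => (m i : ℝ)), e4, e5]

lemma degDiv_eq_zero_of_isPrincipal {D : Div G} {f : RatFn G} (h : G.IsPrincipal D f) :
    G.degDiv D = 0 := by
  have hinj : ∀ e : G.E, Set.InjOn (G.edgePt e) (Set.Ioo 0 (G.len e)) := fun e t ht t' ht' htt =>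
    (edgePt_inj ht.1 ht.2 ht'.1 ht'.2 htt).2
  have hfin : ∀ e : G.E, (Set.Ioo 0 (G.len e) ∩ G.edgePt e ⁻¹' (D.support : Set G.Space)).Finite :=
    fun e => Set.Finite.of_injOn (f := G.edgePt e) (t := (D.support : Set G.Space))
      (fun t ht => ht.2) ((hinj e).mono Set.inter_subset_left) (Finset.finite_toSet _)
  set P : G.E → Finset ℝ := fun e => (hfin e).toFinset with hPdef
  have hP : ∀ e t, t ∈ P e ↔ (0 < t ∧ t < G.len e) ∧ D (G.edgePt e t) ≠ 0 := by
    intro e t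
    simp [hPdef]
  have hedge : ∀ e, ∑ t ∈ P e, (D (G.edgePt e t) : ℝ) =
      G.leftSlope f e (G.len e) - G.rightSlope f e 0 := by
    intro e
    rw [leftSlope, rightSlope, ← PWIntAffine.sum_slope_change (G.len_pos e) (f.piecewise e) (P e)
      (fun u hu => ((hP e u).1 hu).1)]
    · refine Finset.sum_congr rfl fun t ht => ?_
      have := ((hP e t).1 ht).1
      rw [h, ordAt_edgePt f this.1 this.2]
      rfl
    · intro u h0 h1 hu
      have hu' : D (G.edgePt e u) = 0 := by
        by_contra hne
        exact hu ((hP e u).2 ⟨⟨h0, h1⟩, hne⟩)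
      have := h (G.edgePt e u)
      rw [hu', ordAt_edgePt f h0 h1] at this
      rw [Int.cast_zero] at this
      exact this.symm
  have hD : (G.degDiv D : ℝ) = ∑ v : G.V, (D (G.vertexPt v) : ℝ) +
      ∑ e : G.E, ∑ t ∈ P e, (D (G.edgePt e t) : ℝ) := by
    set A : Finset G.Space := Finset.univ.image G.vertexPt with hA
    set B : Finset G.Space := Finset.univ.biUnion fun e : G.E => (P e).image (G.edgePt e) with hB
    have hdisj : Disjoint A B := by
      rw [Finset.disjoint_left]
      rintro x hxA hxB
      obtain ⟨v, -, rfl⟩ := Finset.mem_image.1 hxA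
      obtain ⟨e, -, hx⟩ := Finset.mem_biUnion.1 hxB
      obtain ⟨t, ht, hx⟩ := Finset.mem_image.1 hx
      have := ((hP e t).1 ht).1
      exact edgePt_ne_vertexPt this.1 this.2 v hx
    have hsub : D.support ⊆ A ∪ B := by
      intro x hx
      rcases exists_eq_edgePt_or_vertexPt x with ⟨v, rfl⟩ | ⟨e, t, h0, h1, rfl⟩
      · exact Finset.mem_union_left _ (Finset.mem_image_of_mem _ (Finset.mem_univ v))
      · refine Finset.mem_union_right _ (Finset.mem_biUnion.2 ⟨e, Finset.mem_univ e, ?_⟩)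
        exact Finset.mem_image_of_mem _ ((hP e t).2 ⟨⟨h0, h1⟩, Finsupp.mem_support_iff.1 hx⟩)
    have h1 : (G.degDiv D : ℝ) = ∑ x ∈ A ∪ B, (D x : ℝ) := by
      rw [degDiv, Finsupp.sum, Int.cast_sum]
      refine Finset.sum_subset hsub fun x _ hx => ?_
      simp [Finsupp.notMem_support_iff.1 hx]
    rw [h1, Finset.sum_union hdisj, hA, Finset.sum_image vertexPt_injective.injOn, hB,
      Finset.sum_biUnion]
    · congr 1
      refine Finset.sum_congr rfl fun e _ => ?_
      exact Finset.sum_image fun t ht t' ht' htt =>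
        hinj e ((hP e t).1 ht).1 ((hP e t').1 ht').1 htt
    · intro e _ e' _ hee
      rw [Function.onFun, Finset.disjoint_left]
      rintro x hx hx'
      obtain ⟨t, ht, rfl⟩ := Finset.mem_image.1 hx
      obtain ⟨t', ht', hx⟩ := Finset.mem_image.1 hx'
      have h1 := ((hP e t).1 ht).1
      have h2 := ((hP e' t').1 ht').1
      exact hee (edgePt_inj h2.1 h2.2 h1.1 h1.2 hx).1.symm
  have hV : ∑ v : G.V, (D (G.vertexPt v) : ℝ) =
      ∑ e : G.E, (G.rightSlope f e 0 - G.leftSlope f e (G.len e)) := by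
    simp_rw [h _, ordAt_vertexPt]
    rw [Finset.sum_comm]
    refine Finset.sum_congr rfl fun e _ => ?_
    simp [Finset.sum_add_distrib, sub_eq_add_neg]
  rw [hV, ← Finset.sum_congr rfl fun e _ => (hedge e).symm, ← Finset.sum_add_distrib] at hD
  have : (G.degDiv D : ℝ) = 0 := by simpa using hD
  exact_mod_cast this

/-! ### Construction of rational functions from their kinks -/

/-- The piecewise affine function vanishing for very negative arguments whose slope
increases by `A a` at each `a`. -/
def kinkFn (A : ℝ →₀ ℤ) (t : ℝ) : ℝ := A.sum fun a n => (n : ℝ) * max (t - a) 0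

lemma continuous_kinkFn (A : ℝ →₀ ℤ) : Continuous (kinkFn A) := by
  unfold kinkFn Finsupp.sum
  fun_prop

lemma hasDerivWithinAt_kinkFn_Ici (A : ℝ →₀ ℤ) (t : ℝ) :
    HasDerivWithinAt (kinkFn A) (A.sum fun a n => if a ≤ t then (n : ℝ) else 0)
      (Set.Ici t) t := by
  unfold kinkFn Finsupp.sum
  refine HasDerivWithinAt.fun_sum fun a _ => ?_
  beta_reduce
  split_ifs with h
  · have h1 : HasDerivWithinAt (fun u => (A a : ℝ) * (u - a)) (A a : ℝ) (Set.Ici t) t := by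
      simpa using (((hasDerivAt_id t).sub_const a).const_mul (A a : ℝ)).hasDerivWithinAt
    refine h1.congr (fun u hu => ?_) ?_
    · rw [max_eq_left (sub_nonneg.2 (h.trans hu))]
    · rw [max_eq_left (sub_nonneg.2 h)]
  · rw [not_le] at h
    refine (hasDerivWithinAt_const t (Set.Ici t) (0 : ℝ)).congr_of_eventuallyEq ?_ ?_
    · filter_upwards [Icc_mem_nhdsGE h] with u hu
      rw [max_eq_right (sub_nonpos.2 hu.2), mul_zero]
    · rw [max_eq_right (sub_nonpos.2 h.le), mul_zero]

lemma hasDerivWithinAt_kinkFn_Iic (A : ℝ →₀ ℤ) (t : ℝ) :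
    HasDerivWithinAt (kinkFn A) (A.sum fun a n => if a < t then (n : ℝ) else 0)
      (Set.Iic t) t := by
  unfold kinkFn Finsupp.sum
  refine HasDerivWithinAt.fun_sum fun a _ => ?_
  beta_reduce
  split_ifs with h
  · have h1 : HasDerivWithinAt (fun u => (A a : ℝ) * (u - a)) (A a : ℝ) (Set.Iic t) t := by
      simpa using (((hasDerivAt_id t).sub_const a).const_mul (A a : ℝ)).hasDerivWithinAt
    refine h1.congr_of_eventuallyEq ?_ ?_
    · filter_upwards [Icc_mem_nhdsLE h] with u hu
      rw [max_eq_left (sub_nonneg.2 hu.1)]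
    · rw [max_eq_left (sub_nonneg.2 h.le)]
  · rw [not_lt] at h
    refine (hasDerivWithinAt_const t (Set.Iic t) (0 : ℝ)).congr (fun u hu => ?_) ?_
    · rw [max_eq_right (sub_nonpos.2 (le_trans hu h)), mul_zero]
    · rw [max_eq_right (sub_nonpos.2 h), mul_zero]

/-- A function that is affine with integral slope between consecutive points of a finite
set containing both ends of `[0, L]` is piecewise integral affine. -/
lemma pwIntAffine_of_finset {g : ℝ → ℝ} {L : ℝ} (S : Finset ℝ)
    (h0 : 0 ∈ S) (hL : L ∈ S) (hS : ∀ a ∈ S, 0 ≤ a ∧ a ≤ L)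
    (hg : ∀ u v, u < v → (∀ a ∈ S, a ≤ u ∨ v ≤ a) →
      ∃ (m : ℤ) (b : ℝ), ∀ w, u ≤ w → w ≤ v → g w = m * w + b) :
    PWIntAffine g L := by
  obtain ⟨n, hn⟩ : ∃ n, S.card = n + 1 :=
    Nat.exists_eq_succ_of_ne_zero (Finset.card_ne_zero_of_mem h0)
  set φ := S.orderEmbOfFin hn with hφ
  set t : ℕ → ℝ := fun i => if h : i < n + 1 then φ ⟨i, h⟩ else 0 with ht
  have htφ : ∀ i (h : i < n + 1), t i = φ ⟨i, h⟩ := fun i h => dif_pos h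
  have hmem : ∀ a ∈ S, ∃ j : Fin (n + 1), φ j = a := fun a ha => by
    have : a ∈ Set.range φ := by rw [hφ, Finset.range_orderEmbOfFin]; exact ha
    exact this
  have hφS : ∀ j, φ j ∈ S := fun j => Finset.orderEmbOfFin_mem S hn j
  have hlt : ∀ i, i < n → t i < t (i + 1) := by
    intro i hi
    rw [htφ i (by omega), htφ (i + 1) (by omega)]
    exact φ.strictMono (Fin.mk_lt_mk.2 (Nat.lt_succ_self i))
  have hpiece : ∀ i, ∃ (m : ℤ) (b : ℝ), i < n →
      ∀ w, t i ≤ w → w ≤ t (i + 1) → g w = m * w + b := by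
    intro i
    by_cases hi : i < n
    · obtain ⟨m, b, h⟩ := hg (t i) (t (i + 1)) (hlt i hi) fun a ha => by
        obtain ⟨j, rfl⟩ := hmem a ha
        rw [htφ i (by omega), htφ (i + 1) (by omega), φ.le_iff_le, φ.le_iff_le,
          Fin.le_def, Fin.le_def]
        simp only
        omega
      exact ⟨m, b, fun _ => h⟩
    · exact ⟨0, 0, fun h => absurd h hi⟩
  choose m b hmb using hpiece
  refine ⟨n, t, m, b, ?_, ?_, hlt, hmb⟩
  · obtain ⟨j, hj⟩ := hmem 0 h0
    rw [htφ 0 (by omega)]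
    refine le_antisymm ?_ (hS _ (hφS _)).1
    rw [← hj]
    exact φ.monotone (Fin.zero_le j)
  · obtain ⟨j, hj⟩ := hmem L hL
    rw [htφ n (by omega)]
    refine le_antisymm (hS _ (hφS _)).2 ?_
    rw [← hj]
    exact φ.monotone (Fin.le_def.2 (by simp only; omega))

lemma kinkFn_affine_of_no_kink (A : ℝ →₀ ℤ) (c : ℝ) {u v : ℝ}
    (h : ∀ a ∈ A.support, a ≤ u ∨ v ≤ a) :
    ∃ (m : ℤ) (b : ℝ), ∀ w, u ≤ w → w ≤ v → c + kinkFn A w = m * w + b := by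
  refine ⟨A.sum fun a n => if a ≤ u then n else 0,
    c + A.sum fun a n => if a ≤ u then -(n : ℝ) * a else 0, fun w hu hv => ?_⟩
  unfold kinkFn Finsupp.sum
  rw [Int.cast_sum, Finset.sum_mul, add_left_comm, ← Finset.sum_add_distrib]
  congr 1
  refine Finset.sum_congr rfl fun a ha => ?_
  beta_reduce
  split_ifs with hau
  · rw [max_eq_left (by linarith)]
    ring
  · rw [max_eq_right (by linarith [(h a ha).resolve_left hau])]
    simp

/-- `A` gives on every edge the changes of slope, and `c` the values at the vertices, of
a rational function. -/
structure IsKinkData (c : G.V → ℝ) (A : G.E → ℝ →₀ ℤ) : Prop where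
  mem : ∀ e, ∀ a ∈ (A e).support, 0 ≤ a ∧ a ≤ G.len e
  tgt : ∀ e, c (G.tgt e) = c (G.src e) + (A e).sum fun a n => (n : ℝ) * (G.len e - a)

/-- The divisor of the rational function with changes of slope `A`. -/
def kinkDiv (A : G.E → ℝ →₀ ℤ) : Div G :=
  ∑ e, (A e).sum fun a n =>
    n • (Finsupp.single (G.edgePt e a) 1 - Finsupp.single (G.vertexPt (G.tgt e)) 1)

namespace IsKinkData

variable {c : G.V → ℝ} {A : G.E → ℝ →₀ ℤ}

lemma kinkFn_zero (h : IsKinkData c A) (e : G.E) : kinkFn (A e) 0 = 0 :=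
  Finset.sum_eq_zero fun a ha => by
    beta_reduce
    rw [max_eq_right (by linarith [(h.mem e a ha).1]), mul_zero]

lemma kinkFn_len (h : IsKinkData c A) (e : G.E) :
    c (G.src e) + kinkFn (A e) (G.len e) = c (G.tgt e) := by
  rw [h.tgt e, kinkFn]
  congr 1
  refine Finset.sum_congr rfl fun a ha => ?_
  beta_reduce
  rw [max_eq_left (by linarith [(h.mem e a ha).2])]

/-- The function on the realization determined by kink data. -/
def toFun (h : IsKinkData c A) : G.Space → ℝ :=
  Quot.lift
    (fun p : G.PreR =>
      Sum.elim c (fun q : G.E × ℝ => c (G.src q.1) + kinkFn (A q.1) q.2) p.1)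
    (by
      rintro _ _ (e | e)
      · simp [h.kinkFn_zero]
      · simp [h.kinkFn_len])

lemma toFun_edgePt (h : IsKinkData c A) {e : G.E} {t : ℝ} (h0 : 0 ≤ t) (h1 : t ≤ G.len e) :
    h.toFun (G.edgePt e t) = c (G.src e) + kinkFn (A e) t := by
  rw [edgePt_of_mem h0 h1]
  rfl

lemma continuous_toFun (h : IsKinkData c A) : Continuous h.toFun := by
  have : DiscreteTopology G.V := ⟨rfl⟩
  have : DiscreteTopology G.E := ⟨rfl⟩
  refine continuous_quot_lift _ ?_
  have h1 : Continuous (Sum.elim c fun q : G.E × ℝ => c (G.src q.1) + kinkFn (A q.1) q.2) := by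
    refine continuous_of_discreteTopology.sumElim ?_
    rw [continuous_prod_of_discrete_left]
    intro e
    exact (continuous_kinkFn (A e)).const_add (c (G.src e))
  exact h1.comp continuous_subtype_val

/-- The rational function determined by kink data. -/
def ratFn (h : IsKinkData c A) : RatFn G where
  toFun := h.toFun
  continuous := h.continuous_toFun
  piecewise e := by
    have key : PWIntAffine (fun t => c (G.src e) + kinkFn (A e) t) (G.len e) := by
      refine pwIntAffine_of_finset (insert 0 (insert (G.len e) (A e).support)) (by simp)
        (by simp) ?_ ?_
      · simp only [Finset.mem_insert, forall_eq_or_imp]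
        exact ⟨⟨le_rfl, (G.len_pos e).le⟩, ⟨(G.len_pos e).le, le_rfl⟩, h.mem e⟩
      · exact fun u v _ hS => kinkFn_affine_of_no_kink _ _ fun a ha => hS a (by
          simp only [Finset.mem_insert]; exact Or.inr (Or.inr ha))
    obtain ⟨n, t, m, b, ht0, htn, hlt, haff⟩ := key
    have hmono : ∀ i j, i ≤ j → j ≤ n → t i ≤ t j := by
      intro i j hij
      induction j, hij using Nat.le_induction with
      | base => exact fun _ => le_rfl
      | succ j _ ih => exact fun hj => (ih (by omega)).trans (hlt j (by omega)).le
    refine ⟨n, t, m, b, ht0, htn, hlt, fun i hi u hu hu' => ?_⟩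
    rw [← haff i hi u hu hu']
    exact h.toFun_edgePt ((ht0 ▸ hmono 0 i (by omega) hi.le).trans hu)
      (hu'.trans (htn ▸ hmono (i + 1) n hi le_rfl))

lemma rightSlope_ratFn (h : IsKinkData c A) {e : G.E} {t : ℝ} (h0 : 0 ≤ t) (h1 : t < G.len e) :
    G.rightSlope h.ratFn e t = (A e).sum fun a n => if a ≤ t then (n : ℝ) else 0 := by
  refine HasDerivWithinAt.derivWithin ?_ (uniqueDiffWithinAt_Ici t)
  refine ((hasDerivWithinAt_kinkFn_Ici (A e) t).const_add (c (G.src e))).congr_of_eventuallyEq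
    ?_ (h.toFun_edgePt h0 h1.le)
  filter_upwards [Icc_mem_nhdsGE h1] with u hu
  exact h.toFun_edgePt (h0.trans hu.1) hu.2

lemma leftSlope_ratFn (h : IsKinkData c A) {e : G.E} {t : ℝ} (h0 : 0 < t) (h1 : t ≤ G.len e) :
    G.leftSlope h.ratFn e t = (A e).sum fun a n => if a < t then (n : ℝ) else 0 := by
  refine HasDerivWithinAt.derivWithin ?_ (uniqueDiffWithinAt_Iic t)
  refine ((hasDerivWithinAt_kinkFn_Iic (A e) t).const_add (c (G.src e))).congr_of_eventuallyEq
    ?_ (h.toFun_edgePt h0.le h1)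
  filter_upwards [Icc_mem_nhdsLE h0] with u hu
  exact h.toFun_edgePt hu.1 (hu.2.trans h1)

lemma isPrincipal_kinkDiv (h : IsKinkData c A) : G.IsPrincipal (kinkDiv A) h.ratFn := by
  intro x
  have hx : (kinkDiv A x : ℝ) = ∑ e, (A e).sum fun a n =>
      (n : ℝ) * ((if G.edgePt e a = x then 1 else 0) -
        (if G.vertexPt (G.tgt e) = x then 1 else 0)) := by
    simp [kinkDiv, Finsupp.sum, Finsupp.finsetSum_apply, Finsupp.single_apply]
  rw [hx]
  rcases exists_eq_edgePt_or_vertexPt x with ⟨v, rfl⟩ | ⟨e, t, h0, h1, rfl⟩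
  · rw [ordAt_vertexPt]
    refine Finset.sum_congr rfl fun e _ => ?_
    have hL := G.len_pos e
    rw [h.rightSlope_ratFn le_rfl hL, h.leftSlope_ratFn hL le_rfl]
    simp only [Finsupp.sum, vertexPt_injective.eq_iff]
    have hsrc : (if G.src e = v then ∑ a ∈ (A e).support, (if a ≤ 0 then (A e a : ℝ) else 0)
        else 0) = ∑ a ∈ (A e).support,
          if G.src e = v then (if a ≤ 0 then (A e a : ℝ) else 0) else 0 := by
      split_ifs <;> simp
    have htgt : (if G.tgt e = v then
        -∑ a ∈ (A e).support, (if a < G.len e then (A e a : ℝ) else 0)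
        else 0) = ∑ a ∈ (A e).support,
          if G.tgt e = v then -(if a < G.len e then (A e a : ℝ) else 0) else 0 := by
      split_ifs <;> simp
    rw [hsrc, htgt, ← Finset.sum_add_distrib]
    refine Finset.sum_congr rfl fun a ha => ?_
    obtain ⟨ha0, ha1⟩ := h.mem e a ha
    rcases ha0.eq_or_lt with rfl | ha0
    · simp only [edgePt_zero, vertexPt_injective.eq_iff, le_refl, hL, if_true]
      split_ifs <;> simp
    rcases ha1.eq_or_lt with rfl | ha1
    · simp [vertexPt_injective.eq_iff, hL.not_ge]
    · simp only [edgePt_ne_vertexPt ha0 ha1, ha0.not_ge, ha1, if_true, if_false]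
      split_ifs <;> simp
  · rw [ordAt_edgePt _ h0 h1, h.rightSlope_ratFn h0.le h1, h.leftSlope_ratFn h0 h1.le]
    rw [Finset.sum_eq_single e]
    · unfold Finsupp.sum
      rw [← Finset.sum_sub_distrib]
      refine Finset.sum_congr rfl fun a ha => ?_
      beta_reduce
      rw [if_neg (edgePt_ne_vertexPt h0 h1 _).symm]
      obtain ⟨ha0, ha1⟩ := h.mem e a ha
      by_cases hat : a = t
      · subst hat; simp
      have hne : G.edgePt e a ≠ G.edgePt e t := by
        rcases ha0.eq_or_lt with rfl | ha0
        · rw [edgePt_zero]; exact (edgePt_ne_vertexPt h0 h1 _).symm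
        rcases ha1.eq_or_lt with rfl | ha1
        · rw [edgePt_len]; exact (edgePt_ne_vertexPt h0 h1 _).symm
        exact fun h' => hat (edgePt_inj ha0 ha1 h0 h1 h').2
      rw [if_neg hne]
      have : a ≤ t ↔ a < t := ⟨fun h' => lt_of_le_of_ne h' hat, le_of_lt⟩
      simp [this]
    · intro e' _ hee
      refine Finset.sum_eq_zero fun a ha => ?_
      beta_reduce
      rw [if_neg (edgePt_ne_vertexPt h0 h1 _).symm]
      obtain ⟨ha0, ha1⟩ := h.mem e' a ha
      rw [if_neg, sub_zero, mul_zero]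
      rcases ha0.eq_or_lt with rfl | ha0
      · rw [edgePt_zero]; exact (edgePt_ne_vertexPt h0 h1 _).symm
      rcases ha1.eq_or_lt with rfl | ha1
      · rw [edgePt_len]; exact (edgePt_ne_vertexPt h0 h1 _).symm
      exact fun h' => hee (edgePt_inj ha0 ha1 h0 h1 h').1
    · exact fun h' => absurd (Finset.mem_univ e) h'

lemma add {c' : G.V → ℝ} {A' : G.E → ℝ →₀ ℤ} (h : IsKinkData c A) (h' : IsKinkData c' A') :
    IsKinkData (c + c') (A + A') where
  mem e a ha := by
    rcases Finset.mem_union.1 (Finsupp.support_add ha) with ha | ha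
    · exact h.mem e a ha
    · exact h'.mem e a ha
  tgt e := by
    rw [Pi.add_apply, Pi.add_apply, Pi.add_apply, h.tgt e, h'.tgt e,
      Finsupp.sum_add_index' (by simp) (by intros; push_cast; ring)]
    ring

lemma neg (h : IsKinkData c A) : IsKinkData (-c) (-A) where
  mem e a ha := h.mem e a (by simpa using ha)
  tgt e := by
    rw [Pi.neg_apply, Pi.neg_apply, Pi.neg_apply, h.tgt e, Finsupp.sum_neg_index (by simp)]
    simp [Finsupp.sum]
    ring

end IsKinkData

/-- The group of divisors of rational functions given by kink data. -/
def kinkSubgroup (G : CombGraph) : AddSubgroup (Div G) where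
  carrier := {D | ∃ c A, IsKinkData c A ∧ kinkDiv A = D}
  zero_mem' := ⟨0, 0, ⟨by simp, by simp⟩, by simp [kinkDiv]⟩
  add_mem' := by
    rintro _ _ ⟨c, A, h, rfl⟩ ⟨c', A', h', rfl⟩
    refine ⟨_, _, h.add h', ?_⟩
    simp only [kinkDiv, Pi.add_apply, ← Finset.sum_add_distrib]
    refine Finset.sum_congr rfl fun e _ => ?_
    exact Finsupp.sum_add_index' (by simp) (by intros; rw [add_smul])
  neg_mem' := by
    rintro _ ⟨c, A, h, rfl⟩
    refine ⟨_, _, h.neg, ?_⟩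
    simp only [kinkDiv, Pi.neg_apply, ← Finset.sum_neg_distrib]
    refine Finset.sum_congr rfl fun e _ => ?_
    rw [Finsupp.sum_neg_index (by simp)]
    simp only [Finsupp.sum, neg_smul, Finset.sum_neg_distrib]

lemma linEquiv_of_sub_mem {D D' : Div G} (h : D - D' ∈ kinkSubgroup G) : G.LinEquiv D D' := by
  obtain ⟨c, A, hA, hD⟩ := h
  exact ⟨hA.ratFn, hD ▸ hA.isPrincipal_kinkDiv⟩

/-! ### Linear equivalences along bridges and loops -/

/-- Every point of a bridge is equivalent to its end; `χ` is the indicator function of the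
component of the complement of the bridge containing that end. -/
lemma bridge_mem_kinkSubgroup {e : G.E} (χ : G.V → ℝ) (hsrc : χ (G.src e) = 0)
    (htgt : χ (G.tgt e) = 1) (hχ : ∀ e', e' ≠ e → χ (G.tgt e') = χ (G.src e'))
    {a : ℝ} (h0 : 0 ≤ a) (h1 : a ≤ G.len e) :
    (Finsupp.single (G.edgePt e a) 1 - Finsupp.single (G.vertexPt (G.tgt e)) 1 : Div G) ∈
      kinkSubgroup G := by
  refine ⟨fun v => (G.len e - a) * χ v, Pi.single e (Finsupp.single a 1), ⟨?_, ?_⟩, ?_⟩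
  · intro e' b hb
    rcases eq_or_ne e' e with rfl | he
    · rw [Pi.single_eq_same] at hb
      obtain rfl : b = a := by simpa using Finsupp.support_single_subset hb
      exact ⟨h0, h1⟩
    · simp [Pi.single_eq_of_ne he] at hb
  · intro e'
    rcases eq_or_ne e' e with rfl | he
    · simp [hsrc, htgt]
    · simp [Pi.single_eq_of_ne he, hχ e' he]
  · rw [kinkDiv, Finset.sum_eq_single e]
    · simp
    · intro e' _ he
      simp [Pi.single_eq_of_ne he]
    · simp

lemma loop_mem_kinkSubgroup {e : G.E} (he : G.src e = G.tgt e) (B : ℝ →₀ ℤ)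
    (hB : ∀ a ∈ B.support, 0 ≤ a ∧ a ≤ G.len e)
    (hsum : (B.sum fun a n => (n : ℝ) * (G.len e - a)) = 0) :
    (B.sum fun a n =>
      n • (Finsupp.single (G.edgePt e a) 1 - Finsupp.single (G.vertexPt (G.tgt e)) 1) : Div G) ∈
      kinkSubgroup G := by
  refine ⟨0, Pi.single e B, ⟨?_, ?_⟩, ?_⟩
  · intro e' b hb
    rcases eq_or_ne e' e with rfl | he
    · rw [Pi.single_eq_same] at hb
      exact hB b hb
    · simp [Pi.single_eq_of_ne he] at hb
  · intro e'
    rcases eq_or_ne e' e with rfl | he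
    · simp [hsum]
    · simp [Pi.single_eq_of_ne he]
  · rw [kinkDiv, Finset.sum_eq_single e]
    · simp
    · intro e' _ he
      simp [Pi.single_eq_of_ne he]
    · simp

/-- The sum of two points of a loop is equivalent to the sum of its base point and
another point of the loop. -/
lemma exists_loop_add {e : G.E} (he : G.src e = G.tgt e) {a b : ℝ} (ha0 : 0 ≤ a)
    (ha1 : a ≤ G.len e) (hb0 : 0 ≤ b) (hb1 : b ≤ G.len e) :
    ∃ c, 0 ≤ c ∧ c ≤ G.len e ∧
      (Finsupp.single (G.edgePt e a) 1 + Finsupp.single (G.edgePt e b) 1 -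
        (Finsupp.single (G.vertexPt (G.tgt e)) 1 + Finsupp.single (G.edgePt e c) 1) : Div G) ∈
      kinkSubgroup G := by
  have hL := G.len_pos e
  obtain ⟨c, k, hc0, hc1, hk⟩ : ∃ (c : ℝ) (k : ℤ), 0 ≤ c ∧ c ≤ G.len e ∧
      (1 - k) * G.len e = a + b - c := by
    rcases le_total (a + b) (G.len e) with h | h
    · exact ⟨a + b, 1, by linarith, h, by simp⟩
    · exact ⟨a + b - G.len e, 0, by linarith, by linarith, by simp⟩
  refine ⟨c, hc0, hc1, ?_⟩
  have hadd {M : Type} [AddCommGroup M] [Module ℤ M] (F : ℝ → ℤ → M)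
      (hF : ∀ x m n, F x (m + n) = F x m + F x n) :
      (Finsupp.single a 1 + Finsupp.single b 1 +
        (Finsupp.single c (-1) + Finsupp.single 0 (-k))).sum F =
      F a 1 + F b 1 + (F c (-1) + F 0 (-k)) := by
    have h0 : ∀ x, F x 0 = 0 := fun x => by simpa using hF x 0 0
    rw [Finsupp.sum_add_index' h0 hF, Finsupp.sum_add_index' h0 hF, Finsupp.sum_add_index' h0 hF]
    simp only [Finsupp.sum_single_index (h0 _)]
  have key := loop_mem_kinkSubgroup he (Finsupp.single a 1 + Finsupp.single b 1 +
        (Finsupp.single c (-1) + Finsupp.single 0 (-k))) ?_ ?_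
  · rw [hadd _ (by intros; rw [add_smul]), edgePt_zero, he] at key
    convert key using 1
    simp only [one_smul, neg_smul, sub_self, smul_zero]
    abel
  · intro x hx
    have hx' : x = a ∨ x = b ∨ x = c ∨ x = 0 := by
      by_contra! hne
      simp [hne.1, hne.2.1, hne.2.2.1, hne.2.2.2] at hx
    rcases hx' with rfl | rfl | rfl | rfl
    exacts [⟨ha0, ha1⟩, ⟨hb0, hb1⟩, ⟨hc0, hc1⟩, ⟨le_rfl, hL.le⟩]
  · rw [hadd _ (by intros; push_cast; ring)]
    push_cast
    linear_combination hk

/-- A positive multiple of a point of a loop is equivalent to the sum of a multiple of the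
base point and a single point. -/
lemma exists_loop_nsmul {e : G.E} (he : G.src e = G.tgt e) {a : ℝ} (ha0 : 0 ≤ a)
    (ha1 : a ≤ G.len e) (n : ℕ) :
    ∃ c, 0 ≤ c ∧ c ≤ G.len e ∧
      (((n + 1 : ℕ) : ℤ) • Finsupp.single (G.edgePt e a) 1 -
        ((n : ℤ) • Finsupp.single (G.vertexPt (G.tgt e)) 1 + Finsupp.single (G.edgePt e c) 1) :
        Div G) ∈ kinkSubgroup G := by
  induction n with
  | zero => exact ⟨a, ha0, ha1, by simp⟩
  | succ n ih =>
    obtain ⟨b, hb0, hb1, hb⟩ := ih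
    obtain ⟨c, hc0, hc1, hc⟩ := exists_loop_add he ha0 ha1 hb0 hb1
    refine ⟨c, hc0, hc1, ?_⟩
    convert add_mem hb hc using 1
    push_cast
    module

/-- Twice the base point of a loop is equivalent to an effective divisor containing any
given point of the loop. -/
lemma exists_loop_reflection {e : G.E} (he : G.src e = G.tgt e) {a : ℝ} (ha0 : 0 ≤ a)
    (ha1 : a ≤ G.len e) :
    ∃ c, (Finsupp.single (G.edgePt e a) 1 + Finsupp.single c 1 -
        (2 : ℤ) • Finsupp.single (G.vertexPt (G.tgt e)) 1 : Div G) ∈ kinkSubgroup G := by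
  refine ⟨G.edgePt e (G.len e - a), ?_⟩
  have key := loop_mem_kinkSubgroup he
    (Finsupp.single a 1 + (Finsupp.single (G.len e - a) 1 + Finsupp.single 0 (-1))) ?_ ?_
  · rw [Finsupp.sum_add_index' (by simp) (by intros; rw [add_smul]),
      Finsupp.sum_add_index' (by simp) (by intros; rw [add_smul]),
      Finsupp.sum_single_index (by simp), Finsupp.sum_single_index (by simp),
      Finsupp.sum_single_index (by simp), edgePt_zero, he] at key
    convert key using 1
    module
  · intro x hx
    have hx' : x = a ∨ x = G.len e - a ∨ x = 0 := by
      by_contra! hne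
      simp [hne.1, hne.2.1, hne.2.2] at hx
    rcases hx' with rfl | rfl | rfl
    exacts [⟨ha0, ha1⟩, ⟨by linarith, by linarith⟩, ⟨le_rfl, (G.len_pos e).le⟩]
  · rw [Finsupp.sum_add_index' (by simp) (by intros; push_cast; ring),
      Finsupp.sum_add_index' (by simp) (by intros; push_cast; ring),
      Finsupp.sum_single_index (by simp), Finsupp.sum_single_index (by simp),
      Finsupp.sum_single_index (by simp)]
    push_cast
    ring

/-! ### A criterion for all points to be Weierstrass points -/

lemma degDiv_add (D D' : Div G) : G.degDiv (D + D') = G.degDiv D + G.degDiv D' :=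
  Finsupp.sum_add_index' (by simp) (by simp)

lemma degDiv_zsmul_single (n : ℤ) (x : G.Space) :
    G.degDiv (n • Finsupp.single x 1) = n := by
  simp [degDiv]

lemma Effective.degDiv_nonneg {E : Div G} (hE : G.Effective E) : 0 ≤ G.degDiv E :=
  Finset.sum_nonneg fun x _ => hE x

lemma Effective.add {E E' : Div G} (hE : G.Effective E) (hE' : G.Effective E') :
    G.Effective (E + E') := fun x => by
  simpa using add_nonneg (hE x) (hE' x)

lemma effective_zsmul_single {n : ℤ} (hn : 0 ≤ n) (x : G.Space) :
    G.Effective (n • Finsupp.single x 1) := fun y => by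
  rw [Finsupp.smul_apply, Finsupp.single_apply]
  split_ifs <;> simp [hn]

lemma Effective.eq_zero_of_degDiv_eq_zero {E : Div G} (hE : G.Effective E)
    (h : G.degDiv E = 0) : E = 0 := by
  ext x
  by_contra hx
  exact hx ((Finset.sum_eq_zero_iff_of_nonneg fun y _ => hE y).1 h x
    (Finsupp.mem_support_iff.2 hx))

lemma Effective.exists_eq_single {E : Div G} (hE : G.Effective E) (h : G.degDiv E = 1) :
    ∃ x, E = Finsupp.single x 1 := by
  obtain ⟨x, hx⟩ : ∃ x, E x ≠ 0 := by
    by_contra! h0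
    obtain rfl : E = 0 := Finsupp.ext h0
    simp [degDiv] at h
  have hE' : G.Effective (E - Finsupp.single x 1) := fun y => by
    rw [Finsupp.sub_apply, Finsupp.single_apply]
    split_ifs with hxy
    · subst hxy
      have := hE x
      omega
    · simpa using hE y
  refine ⟨x, sub_eq_zero.1 (hE'.eq_zero_of_degDiv_eq_zero ?_)⟩
  have h1 := degDiv_add (E - Finsupp.single x 1) ((1 : ℤ) • Finsupp.single x 1)
  rw [degDiv_zsmul_single, one_smul, sub_add_cancel, h] at h1
  omega

lemma one_le_Rk {n : ℤ} (hn : 0 ≤ n) (x : G.Space)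
    (h : ∀ y : G.Space, ∃ E' : Div G, G.Effective E' ∧
      G.LinEquiv (n • Finsupp.single x 1 - Finsupp.single y 1) E') :
    1 ≤ G.Rk (n • Finsupp.single x 1) := by
  refine le_csSup ⟨n, fun k hk => ?_⟩ fun E hE hdeg => ?_
  · by_contra! hnk
    obtain ⟨E', hE', f, hf⟩ := hk (k • Finsupp.single x 1)
      (effective_zsmul_single (hn.trans hnk.le) x) (degDiv_zsmul_single k x)
    have h0 := degDiv_eq_zero_of_isPrincipal hf
    have h1 := degDiv_add
      (n • Finsupp.single x 1 - k • Finsupp.single x 1 - E' : Div G) E'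
    rw [sub_add_cancel, ← sub_smul, degDiv_zsmul_single, sub_smul, h0] at h1
    have := hE'.degDiv_nonneg
    omega
  · obtain ⟨y, rfl⟩ := hE.exists_eq_single hdeg
    exact h y

/-- If twice a point `w` can be moved to any point, and `n` times `x` can be moved to
`w` up to one chip, then `n • x` has positive rank. -/
lemma one_le_Rk_of_center {n : ℤ} (hn : 3 ≤ n) (w x q : G.Space)
    (hx : (n • Finsupp.single x 1 - ((n - 1) • Finsupp.single w 1 + Finsupp.single q 1) : Div G) ∈
      kinkSubgroup G)
    (hw : ∀ y, ∃ c, (Finsupp.single y 1 + Finsupp.single c 1 -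
      (2 : ℤ) • Finsupp.single w 1 : Div G) ∈ kinkSubgroup G) :
    1 ≤ G.Rk (n • Finsupp.single x 1) := by
  refine one_le_Rk (by omega) x fun y => ?_
  obtain ⟨c, hc⟩ := hw y
  refine ⟨(n - 3) • Finsupp.single w 1 + ((1 : ℤ) • Finsupp.single c 1 +
    (1 : ℤ) • Finsupp.single q 1), ?_, linEquiv_of_sub_mem ?_⟩
  · exact (effective_zsmul_single (by omega) w).add
      ((effective_zsmul_single zero_le_one c).add (effective_zsmul_single zero_le_one q))
  · convert sub_mem hx hc using 1
    module

end CombGraph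

namespace Og

/-- The vertex at the start of the path. -/
def center (g : ℕ) (hg : 3 ≤ g) (ℓ : OgE g → ℝ) (hℓ : ∀ e, 0 < ℓ e) : (Og g hg ℓ hℓ).Space :=
  (Og g hg ℓ hℓ).vertexPt (Sum.inr ⟨0, by omega⟩ : OgV g)

variable {g : ℕ} {hg : 3 ≤ g} {ℓ : OgE g → ℝ} {hℓ : ∀ e, 0 < ℓ e}

lemma genus_eq : (Og g hg ℓ hℓ).genus = g := by
  have hE : Fintype.card (Og g hg ℓ hℓ).E = g + (g + (g - 3)) := by
    change Fintype.card (OgE g) = _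
    simp
  have hV : Fintype.card (Og g hg ℓ hℓ).V = g + (g - 2) := by
    change Fintype.card (OgV g) = _
    simp
  rw [CombGraph.genus, hE, hV]
  omega

lemma bridge_sub_mem (i : Fin g) {a : ℝ} (h0 : 0 ≤ a) (h1 : a ≤ ℓ (Sum.inr (Sum.inl i))) :
    (Finsupp.single ((Og g hg ℓ hℓ).edgePt (Sum.inr (Sum.inl i)) a) 1 -
      Finsupp.single ((Og g hg ℓ hℓ).vertexPt
        ((Og g hg ℓ hℓ).tgt (Sum.inr (Sum.inl i)))) 1 : (Og g hg ℓ hℓ).Div) ∈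
      (Og g hg ℓ hℓ).kinkSubgroup := by
  refine CombGraph.bridge_mem_kinkSubgroup (G := Og g hg ℓ hℓ)
    (Sum.elim (fun j => if j = i then 0 else 1) fun _ => 1 : OgV g → ℝ) ?_ ?_ ?_ h0 h1
  · simp [Og]
  · simp [Og]
  · rintro (j | j | j) hj
    · simp [Og]
    · have : j ≠ i := fun h => hj (by rw [h])
      simp [Og, this]
    · simp [Og]

lemma path_sub_mem (j : Fin (g - 3)) {a : ℝ} (h0 : 0 ≤ a)
    (h1 : a ≤ ℓ (Sum.inr (Sum.inr j))) :
    (Finsupp.single ((Og g hg ℓ hℓ).edgePt (Sum.inr (Sum.inr j)) a) 1 -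
      Finsupp.single ((Og g hg ℓ hℓ).vertexPt
        ((Og g hg ℓ hℓ).tgt (Sum.inr (Sum.inr j)))) 1 : (Og g hg ℓ hℓ).Div) ∈
      (Og g hg ℓ hℓ).kinkSubgroup := by
  refine CombGraph.bridge_mem_kinkSubgroup (G := Og g hg ℓ hℓ)
    (Sum.elim (fun i => if j.val < min (i.val - 1) (g - 3) then 1 else 0)
      fun k => if j.val < k.val then 1 else 0 : OgV g → ℝ) ?_ ?_ ?_ h0 h1
  · simp [Og]
  · simp [Og]
  · rintro (k | k | k) hk
    · simp [Og]
    · simp [Og]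
    · have hne : j.val ≠ k.val := fun h => hk (by rw [Fin.ext h])
      have : j.val < k.val + 1 ↔ j.val < k.val := by omega
      simp [Og, this]

lemma path_vertex_sub_center_mem (k : ℕ) (hk : k < g - 2) :
    (Finsupp.single ((Og g hg ℓ hℓ).vertexPt (Sum.inr ⟨k, hk⟩ : OgV g)) 1 -
      Finsupp.single (center g hg ℓ hℓ) 1 : (Og g hg ℓ hℓ).Div) ∈
      (Og g hg ℓ hℓ).kinkSubgroup := by
  induction k with
  | zero => rw [center, sub_self]; exact zero_mem _
  | succ k ih =>
    have h := path_sub_mem (hg := hg) (hℓ := hℓ) (⟨k, by omega⟩ : Fin (g - 3)) le_rfl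
      (hℓ _).le
    rw [CombGraph.edgePt_zero (G := Og g hg ℓ hℓ) (Sum.inr (Sum.inr ⟨k, by omega⟩))] at h
    convert sub_mem (ih (by omega)) h using 1
    exact (sub_sub_sub_cancel_left _ _ _).symm

lemma vertex_sub_center_mem (v : (Og g hg ℓ hℓ).V) :
    (Finsupp.single ((Og g hg ℓ hℓ).vertexPt v) 1 -
      Finsupp.single (center g hg ℓ hℓ) 1 : (Og g hg ℓ hℓ).Div) ∈
      (Og g hg ℓ hℓ).kinkSubgroup := by
  obtain i | k := v
  · have h := bridge_sub_mem (hg := hg) (hℓ := hℓ) i le_rfl (hℓ _).le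
    rw [CombGraph.edgePt_zero (G := Og g hg ℓ hℓ) (Sum.inr (Sum.inl i))] at h
    convert add_mem h (path_vertex_sub_center_mem (min (i.val - 1) (g - 3)) (by omega)) using 1
    exact (sub_add_sub_cancel _ _ _).symm
  · exact path_vertex_sub_center_mem k.val k.isLt

/-- A point outside of the loops is equivalent to the center; any other lies on a loop. -/
lemma sub_center_mem_or_loop (x : (Og g hg ℓ hℓ).Space) :
    (Finsupp.single x 1 - Finsupp.single (center g hg ℓ hℓ) 1 : (Og g hg ℓ hℓ).Div) ∈
      (Og g hg ℓ hℓ).kinkSubgroup ∨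
    ∃ e : (Og g hg ℓ hℓ).E, (Og g hg ℓ hℓ).src e = (Og g hg ℓ hℓ).tgt e ∧
      ∃ t, 0 ≤ t ∧ t ≤ (Og g hg ℓ hℓ).len e ∧ x = (Og g hg ℓ hℓ).edgePt e t := by
  rcases CombGraph.exists_eq_edgePt_or_vertexPt x with ⟨v, rfl⟩ | ⟨e, t, h0, h1, rfl⟩
  · exact Or.inl (vertex_sub_center_mem v)
  obtain i | i | j := e
  · exact Or.inr ⟨Sum.inl i, rfl, t, h0.le, h1.le, rfl⟩
  · left
    have h := add_mem (bridge_sub_mem (hg := hg) (hℓ := hℓ) i h0.le h1.le)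
      (vertex_sub_center_mem ((Og g hg ℓ hℓ).tgt (Sum.inr (Sum.inl i))))
    rwa [sub_add_sub_cancel] at h
  · left
    have h := add_mem (path_sub_mem (hg := hg) (hℓ := hℓ) j h0.le h1.le)
      (vertex_sub_center_mem ((Og g hg ℓ hℓ).tgt (Sum.inr (Sum.inr j))))
    rwa [sub_add_sub_cancel] at h

lemma exists_center_move (y : (Og g hg ℓ hℓ).Space) :
    ∃ c, (Finsupp.single y 1 + Finsupp.single c 1 -
      (2 : ℤ) • Finsupp.single (center g hg ℓ hℓ) 1 : (Og g hg ℓ hℓ).Div) ∈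
      (Og g hg ℓ hℓ).kinkSubgroup := by
  rcases sub_center_mem_or_loop y with h | ⟨e, he, t, h0, h1, rfl⟩
  · refine ⟨center g hg ℓ hℓ, ?_⟩
    convert h using 1
    module
  · obtain ⟨c, hc⟩ := CombGraph.exists_loop_reflection he h0 h1
    refine ⟨c, ?_⟩
    convert add_mem hc (zsmul_mem (vertex_sub_center_mem ((Og g hg ℓ hℓ).tgt e)) 2) using 1
    module

lemma exists_nsmul_sub_center_mem (n : ℕ) (x : (Og g hg ℓ hℓ).Space) :
    ∃ q, (((n + 1 : ℕ) : ℤ) • Finsupp.single x 1 -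
      ((n : ℤ) • Finsupp.single (center g hg ℓ hℓ) 1 + Finsupp.single q 1) :
        (Og g hg ℓ hℓ).Div) ∈ (Og g hg ℓ hℓ).kinkSubgroup := by
  rcases sub_center_mem_or_loop x with h | ⟨e, he, t, h0, h1, rfl⟩
  · refine ⟨center g hg ℓ hℓ, ?_⟩
    convert zsmul_mem h ((n + 1 : ℕ) : ℤ) using 1
    push_cast
    module
  · obtain ⟨c, -, -, hc⟩ := CombGraph.exists_loop_nsmul he h0 h1 n
    refine ⟨(Og g hg ℓ hℓ).edgePt e c, ?_⟩
    convert add_mem hc (zsmul_mem (vertex_sub_center_mem ((Og g hg ℓ hℓ).tgt e)) (n : ℤ)) using 1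
    module

end Og

/-- Statement 19: for `g ≥ 3`, every point of a metric graph with underlying
combinatorial model `O_g` (with arbitrary positive edge lengths) is a Weierstrass
point. -/
theorem og_all_points_weierstrass (g : ℕ) (hg : 3 ≤ g) (ℓ : OgE g → ℝ)
    (hℓ : ∀ e, 0 < ℓ e) :
    (Og g hg ℓ hℓ).genus = g ∧
    ∀ x : (Og g hg ℓ hℓ).Space, (Og g hg ℓ hℓ).IsWeierstrass x := by
  refine ⟨Og.genus_eq, fun x => ?_⟩
  obtain ⟨q, hq⟩ := Og.exists_nsmul_sub_center_mem (g - 1) x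
  rw [CombGraph.IsWeierstrass, Og.genus_eq]
  refine CombGraph.one_le_Rk_of_center (by omega) _ x q ?_ Og.exists_center_move
  convert hq using 4 <;> omega
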